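/- There exist a spherical triangle Δ (given by linearly independent unit vectors in ℝ³) whose corner angles are π/2, π/3, and 5π/18, and a family T₁, …, T₃₆ of subsets of the unit sphere S² in ℝ³ such that each Tᵢ is the image of Δ under a linear isometry of ℝ³, the union of the Tᵢ is S², and the interiors of the Tᵢ in the subspace topology of S² are pairwise disjoint. -/

import Mathlib

open scoped RealInnerProductSpace

/-- The corner angle of the spherical triangle with vertices `A`, `B`, `C` at the
vertex `A`: the angle between the orthogonal projections of `B` and `C` onto the
tangent plane of the unit sphere at `A`. -/
noncomputable def cornerAngle (A B C : EuclideanSpace ℝ (Fin 3)) : ℝ :=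
  InnerProductGeometry.angle (B - ⟪B, A⟫ • A) (C - ⟪C, A⟫ • A)

/-- The spherical triangle with vertices `A`, `B`, `C`: the intersection of the unit
sphere with the cone `{sA + tB + uC : s, t, u ≥ 0}`. -/
def sphericalTriangle (A B C : EuclideanSpace ℝ (Fin 3)) : Set (EuclideanSpace ℝ (Fin 3)) :=
  Metric.sphere 0 1 ∩
    {x | ∃ s t u : ℝ, 0 ≤ s ∧ 0 ≤ t ∧ 0 ≤ u ∧ x = s • A + t • B + u • C}


/-! ### Exact arithmetic in the cubic field `ℚ(2 cos 40°)` -/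

/-- The element `a + b τ + c τ²` of `ℤ[τ]`, where `τ = 2 cos (2π/9)`. -/
structure K3 where
  a : ℤ
  b : ℤ
  c : ℤ

/-- Triples of elements of `ℤ[τ]`. -/
structure Vec where
  x : K3
  y : K3
  z : K3

/-- A tile: three vertices and the three dual functionals. -/
structure Tile where
  p : Vec
  q : Vec
  r : Vec
  f : Vec
  g : Vec
  h : Vec

/-- Subdivision tree of a triangular cone. -/
inductive SubTree where
  | leaf (i : ℕ) : SubTree
  | rot (t : SubTree) : SubTree
  | node (w : Vec) (s t u : K3) (l r : SubTree) : SubTree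

def K3.add (k l : K3) : K3 := ⟨k.a + l.a, k.b + l.b, k.c + l.c⟩
def K3.neg (k : K3) : K3 := ⟨-k.a, -k.b, -k.c⟩
/-- Multiplication modulo `τ³ = 3 τ - 1`. -/
def K3.mul (k l : K3) : K3 :=
  ⟨k.a * l.a - (k.b * l.c + k.c * l.b),
   k.a * l.b + k.b * l.a + 3 * (k.b * l.c + k.c * l.b) - k.c * l.c,
   k.a * l.c + k.b * l.b + k.c * l.a + 3 * (k.c * l.c)⟩
def K3.beq (k l : K3) : Bool := decide (k.a = l.a) && (decide (k.b = l.b) && decide (k.c = l.c))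
def K3.ofInt (n : ℤ) : K3 := ⟨n, 0, 0⟩

/-- A lower bound for `10^40 (a + b τ + c τ²)`. -/
def K3.low (k : K3) : ℤ :=
  k.a * 10 ^ 40 +
  (if 0 ≤ k.b then k.b * 153208888623795607040 else k.b * 153208888623795607041) * 10 ^ 20 +
  (if 0 ≤ k.c then k.c * 153208888623795607040 ^ 2 else k.c * 153208888623795607041 ^ 2)

def K3.nn (k : K3) : Bool := decide (0 ≤ k.low)
def K3.pos (k : K3) : Bool := decide (0 < k.low)

def Vec.dot (v w : Vec) : K3 := (v.x.mul w.x).add ((v.y.mul w.y).add (v.z.mul w.z))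
def Vec.neg (v : Vec) : Vec := ⟨v.x.neg, v.y.neg, v.z.neg⟩

/-- Rows of three times the Gram matrix of the basic triangle. -/
def gramA : Vec := ⟨⟨3, 0, 0⟩, ⟨-4, 1, 2⟩, ⟨9, 0, -3⟩⟩
def gramB : Vec := ⟨⟨-4, 1, 2⟩, ⟨3, 0, 0⟩, ⟨-11, 2, 4⟩⟩
def gramC : Vec := ⟨⟨9, 0, -3⟩, ⟨-11, 2, 4⟩, ⟨3, 0, 0⟩⟩

def Vec.gram (v w : Vec) : K3 := v.dot ⟨gramA.dot w, gramB.dot w, gramC.dot w⟩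

/-- The tile has the right Gram matrix. -/
def Tile.gramOK (t : Tile) : Bool :=
  (t.p.gram t.p).beq ⟨108, 0, 0⟩ && ((t.q.gram t.q).beq ⟨108, 0, 0⟩ &&
  ((t.r.gram t.r).beq ⟨108, 0, 0⟩ && ((t.p.gram t.q).beq ⟨-144, 36, 72⟩ &&
  ((t.p.gram t.r).beq ⟨324, 0, -108⟩ && (t.q.gram t.r).beq ⟨-396, 72, 144⟩))))

/-- The functionals are dual to the vertices. -/
def Tile.dualOK (t : Tile) : Bool :=
  (t.f.dot t.p).beq ⟨36, 0, 0⟩ && ((t.f.dot t.q).beq ⟨0, 0, 0⟩ && ((t.f.dot t.r).beq ⟨0, 0, 0⟩ &&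
  ((t.g.dot t.p).beq ⟨0, 0, 0⟩ && ((t.g.dot t.q).beq ⟨36, 0, 0⟩ && ((t.g.dot t.r).beq ⟨0, 0, 0⟩ &&
  ((t.h.dot t.p).beq ⟨0, 0, 0⟩ && ((t.h.dot t.q).beq ⟨0, 0, 0⟩ &&
    (t.h.dot t.r).beq ⟨36, 0, 0⟩)))))))

/-- Product of the matrix of vertices and the matrix of functionals. -/
def Tile.invOK (t : Tile) : Bool :=
  let e (a b c d f g : K3) (n : ℤ) : Bool :=
    ((a.mul b).add ((c.mul d).add (f.mul g))).beq ⟨n, 0, 0⟩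
  e t.p.x t.f.x t.q.x t.g.x t.r.x t.h.x 36 && (e t.p.x t.f.y t.q.x t.g.y t.r.x t.h.y 0 &&
  (e t.p.x t.f.z t.q.x t.g.z t.r.x t.h.z 0 && (e t.p.y t.f.x t.q.y t.g.x t.r.y t.h.x 0 &&
  (e t.p.y t.f.y t.q.y t.g.y t.r.y t.h.y 36 && (e t.p.y t.f.z t.q.y t.g.z t.r.y t.h.z 0 &&
  (e t.p.z t.f.x t.q.z t.g.x t.r.z t.h.x 0 && (e t.p.z t.f.y t.q.z t.g.y t.r.z t.h.y 0 &&
  e t.p.z t.f.z t.q.z t.g.z t.r.z t.h.z 36)))))))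

/-- The functional `v` is nonnegative on the tile `s`, nonpositive on the tile `t`. -/
def sepBy (s t : Tile) (v : Vec) : Bool :=
  (v.dot t.p).neg.nn && ((v.dot t.q).neg.nn && ((v.dot t.r).neg.nn &&
  ((v.dot s.p).nn && ((v.dot s.q).nn && ((v.dot s.r).nn &&
  ((v.dot s.p).pos || ((v.dot s.q).pos || (v.dot s.r).pos)))))))

def sep (s t : Tile) : Bool :=
  sepBy s t s.f || (sepBy s t s.g || (sepBy s t s.h || (sepBy s t t.f.neg ||
  (sepBy s t t.g.neg || (sepBy s t t.h.neg || sepBy s t gramB)))))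

def sepAll : List Tile → Bool
  | [] => true
  | s :: l => l.all (sep s) && sepAll l

/-- The vector `v` lies in the cone of the tile `t`. -/
def Tile.mem (t : Tile) (v : Vec) : Bool :=
  (t.f.dot v).nn && ((t.g.dot v).nn && (t.h.dot v).nn)

def K3.comb (u w s p t q : K3) : Bool := (u.mul w).beq ((s.mul p).add (t.mul q))

def SubTree.check (l : List Tile) : SubTree → Vec → Vec → Vec → Bool
  | .leaf i, p, q, r =>
    match l[i]? with
    | none => false
    | some t => t.mem p && (t.mem q && t.mem r)
  | .rot t, p, q, r => t.check l q r p
  | .node w s t u a b, p, q, r =>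
    s.pos && (t.pos && (u.nn && (K3.comb u w.x s p.x t q.x && (K3.comb u w.y s p.y t q.y &&
    (K3.comb u w.z s p.z t q.z && (a.check l p w r && b.check l w q r))))))

/-- Short form for literal vectors. -/
def vec (a b c d e f g h i : ℤ) : Vec := ⟨⟨a, b, c⟩, ⟨d, e, f⟩, ⟨g, h, i⟩⟩

/-- The 36 tiles (vertices `A`, `B`, `C` and the dual functionals), scaled by `6`. -/
def tiles : List Tile := [
  ⟨(vec 6 0 0 0 0 0 0 0 0), (vec 0 0 0 6 0 0 0 0 0), (vec 0 0 0 0 0 0 6 0 0),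
   (vec 6 0 0 0 0 0 0 0 0), (vec 0 0 0 6 0 0 0 0 0), (vec 0 0 0 0 0 0 6 0 0)⟩,
  ⟨(vec 6 0 0 0 0 0 0 0 0), (vec 0 0 0 6 0 0 0 0 0), (vec 36 0 (-12) 0 0 0 (-6) 0 0),
   (vec 6 0 0 0 0 0 36 0 (-12)), (vec 0 0 0 6 0 0 0 0 0), (vec 0 0 0 0 0 0 (-6) 0 0)⟩,
  ⟨(vec 0 0 0 (-12) 3 6 0 (-3) 0), (vec 0 0 0 6 0 0 0 0 0), (vec 36 0 (-12) 0 0 0 (-6) 0 0),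
   (vec (-6) 0 0 0 0 0 (-36) 0 12), (vec (-12) 3 6 6 0 0 (-66) 12 24), (vec 0 3 0 0 0 0 0 0 0)⟩,
  ⟨(vec 0 0 0 (-12) 3 6 0 (-3) 0), (vec 0 0 0 6 0 0 0 0 0), (vec (-36) 0 12 (-66) 12 24 0 0 0),
   (vec 0 0 0 0 0 0 (-36) 0 12), (vec (-12) 3 6 6 0 0 (-66) 12 24), (vec 0 (-3) 0 0 0 0 0 0 0)⟩,
  ⟨(vec (-6) 0 0 (-12) 3 6 0 3 0), (vec 0 0 0 6 0 0 0 0 0), (vec (-36) 0 12 (-66) 12 24 0 0 0),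
   (vec 0 0 0 0 0 0 36 0 (-12)), (vec (-12) 3 6 6 0 0 0 0 0), (vec 0 (-3) 0 0 0 0 (-6) 0 0)⟩,
  ⟨(vec (-6) 0 0 (-12) 3 6 0 3 0), (vec 0 0 0 6 0 0 0 0 0), (vec 0 0 0 0 0 0 6 0 0),
   (vec (-6) 0 0 0 0 0 0 0 0), (vec (-12) 3 6 6 0 0 0 0 0), (vec 0 3 0 0 0 0 6 0 0)⟩,
  ⟨(vec 6 0 0 0 0 0 0 0 0), (vec (-16) 4 8 (-6) 0 0 0 0 0), (vec 0 0 0 0 0 0 6 0 0),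
   (vec 6 0 0 (-16) 4 8 0 0 0), (vec 0 0 0 (-6) 0 0 0 0 0), (vec 0 0 0 0 0 0 6 0 0)⟩,
  ⟨(vec 0 0 0 (-12) 3 6 0 (-3) 0), (vec 0 0 0 18 0 (-6) 4 (-4) (-2)), (vec 36 0 (-12) 0 0 0 (-6) 0 0),
   (vec 18 0 (-6) (-16) 4 8 108 (-12) (-36)), (vec 12 (-3) (-6) (-6) 0 0 66 (-12) (-24)), (vec 0 3 0 0 0 0 0 0 0)⟩,
  ⟨(vec (-6) 0 0 (-12) 3 6 0 3 0), (vec 16 (-4) (-8) 18 0 (-6) (-4) 4 2), (vec (-36) 0 12 (-66) 12 24 0 0 0),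
   (vec 24 0 (-6) (-16) 4 8 36 0 (-12)), (vec 12 (-3) (-6) (-6) 0 0 0 0 0), (vec 0 (-3) 0 0 0 0 (-6) 0 0)⟩,
  ⟨(vec 6 0 0 0 0 0 0 0 0), (vec (-16) 4 8 (-6) 0 0 0 0 0), (vec 36 0 (-12) 0 0 0 (-6) 0 0),
   (vec 6 0 0 (-16) 4 8 36 0 (-12)), (vec 0 0 0 (-6) 0 0 0 0 0), (vec 0 0 0 0 0 0 (-6) 0 0)⟩,
  ⟨(vec 0 0 0 (-12) 3 6 0 (-3) 0), (vec 0 0 0 18 0 (-6) 4 (-4) (-2)), (vec (-36) 0 12 (-66) 12 24 0 0 0),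
   (vec 24 0 (-6) (-16) 4 8 108 (-12) (-36)), (vec 12 (-3) (-6) (-6) 0 0 66 (-12) (-24)), (vec 0 (-3) 0 0 0 0 0 0 0)⟩,
  ⟨(vec (-6) 0 0 (-12) 3 6 0 3 0), (vec 16 (-4) (-8) 18 0 (-6) (-4) 4 2), (vec 0 0 0 0 0 0 6 0 0),
   (vec 18 0 (-6) (-16) 4 8 0 0 0), (vec 12 (-3) (-6) (-6) 0 0 0 0 0), (vec 0 3 0 0 0 0 6 0 0)⟩,
  ⟨(vec 4 (-4) (-2) 3 0 0 (-5) 2 4), (vec 0 0 0 0 0 0 6 0 0), (vec (-28) 4 8 (-18) 0 6 (-4) 4 2),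
   (vec (-18) 0 6 28 (-4) (-8) 0 0 0), (vec (-15) 6 6 18 0 (-6) 6 0 0), (vec (-3) 0 0 4 (-4) (-2) 0 0 0)⟩,
  ⟨(vec (-26) 8 10 0 (-3) 0 4 (-1) (-2)), (vec 36 0 (-12) 0 0 0 (-6) 0 0), (vec (-16) 4 8 30 (-6) (-12) 8 (-2) (-4)),
   (vec (-30) 6 12 28 (-4) (-8) (-168) 24 60), (vec (-18) 3 6 18 0 (-6) (-108) 12 36), (vec 0 (-3) 0 4 (-4) (-2) (-6) 0 0)⟩,
  ⟨(vec 22 (-4) (-8) 39 (-3) (-12) 1 (-1) (-2)), (vec (-36) 0 12 (-66) 12 24 0 0 0), (vec 44 (-8) (-16) 54 (-6) (-18) (-4) (-2) 2),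
   (vec (-48) 6 18 28 (-4) (-8) (-108) 12 36), (vec (-33) 3 12 18 0 (-6) (-84) 12 30), (vec (-3) (-3) 0 4 (-4) (-2) (-18) 0 6)⟩,
  ⟨(vec 4 (-4) (-2) 3 0 0 (-5) 2 4), (vec (-4) (-4) 0 (-8) 2 4 2 2 0), (vec (-28) 4 8 (-18) 0 6 (-4) 4 2),
   (vec 10 2 (-2) (-16) 4 8 (-16) 4 8), (vec 15 (-6) (-6) (-18) 0 6 (-6) 0 0), (vec (-3) 0 0 4 (-4) (-2) 0 0 0)⟩,
  ⟨(vec (-26) 8 10 0 (-3) 0 4 (-1) (-2)), (vec 16 0 (-4) 4 (-4) (-2) (-2) 0 2), (vec (-16) 4 8 30 (-6) (-12) 8 (-2) (-4)),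
   (vec 10 2 (-2) (-16) 4 8 80 (-8) (-28)), (vec 18 (-3) (-6) (-18) 0 6 108 (-12) (-36)), (vec 0 (-3) 0 4 (-4) (-2) (-6) 0 0)⟩,
  ⟨(vec 22 (-4) (-8) 39 (-3) (-12) 1 (-1) (-2)), (vec (-12) 4 4 (-26) 2 10 0 (-2) (-2)), (vec 44 (-8) (-16) 54 (-6) (-18) (-4) (-2) 2),
   (vec 28 (-4) (-8) (-16) 4 8 80 (-8) (-28)), (vec 33 (-3) (-12) (-18) 0 6 84 (-12) (-30)), (vec (-3) (-3) 0 4 (-4) (-2) (-18) 0 6)⟩,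
  ⟨(vec 18 0 (-6) 12 (-3) (-6) 0 3 0), (vec (-16) 4 8 (-6) 0 0 0 0 0), (vec 0 0 0 0 0 0 6 0 0),
   (vec (-6) 0 0 16 (-4) (-8) 0 0 0), (vec (-12) 3 6 18 0 (-6) 0 0 0), (vec 0 3 0 (-4) 4 2 6 0 0)⟩,
  ⟨(vec 6 0 0 (-21) 3 6 (-3) (-3) 0), (vec 0 0 0 18 0 (-6) 4 (-4) (-2)), (vec 36 0 (-12) 0 0 0 (-6) 0 0),
   (vec (-18) 0 6 16 (-4) (-8) (-108) 12 36), (vec (-21) 3 6 18 0 (-6) (-120) 12 42), (vec 3 3 0 (-4) 4 2 18 0 (-6))⟩,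
  ⟨(vec (-24) 0 6 (-33) 6 12 3 0 0), (vec 16 (-4) (-8) 18 0 (-6) (-4) 4 2), (vec (-36) 0 12 (-66) 12 24 0 0 0),
   (vec (-24) 0 6 16 (-4) (-8) (-36) 0 12), (vec (-33) 6 12 18 0 (-6) (-66) 12 24), (vec 3 0 0 (-4) 4 2 0 0 0)⟩,
  ⟨(vec 18 0 (-6) 12 (-3) (-6) 0 3 0), (vec (-28) 4 8 (-18) 0 6 (-4) 4 2), (vec 0 0 0 0 0 0 6 0 0),
   (vec 18 0 (-6) (-28) 4 8 0 0 0), (vec 12 (-3) (-6) (-18) 0 6 0 0 0), (vec 0 3 0 (-4) 4 2 6 0 0)⟩,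
  ⟨(vec 6 0 0 (-21) 3 6 (-3) (-3) 0), (vec (-16) 4 8 30 (-6) (-12) 8 (-2) (-4)), (vec 36 0 (-12) 0 0 0 (-6) 0 0),
   (vec 30 (-6) (-12) (-28) 4 8 168 (-24) (-60)), (vec 21 (-3) (-6) (-18) 0 6 120 (-12) (-42)), (vec 3 3 0 (-4) 4 2 18 0 (-6))⟩,
  ⟨(vec (-24) 0 6 (-33) 6 12 3 0 0), (vec 44 (-8) (-16) 54 (-6) (-18) (-4) (-2) 2), (vec (-36) 0 12 (-66) 12 24 0 0 0),
   (vec 48 (-6) (-18) (-28) 4 8 108 (-12) (-36)), (vec 33 (-6) (-12) (-18) 0 6 66 (-12) (-24)), (vec 3 0 0 (-4) 4 2 0 0 0)⟩,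
  ⟨(vec 4 (-4) (-2) 6 0 (-3) (-2) 2 1), (vec (-4) (-4) 0 (-8) 2 4 2 2 0), (vec 44 (-8) (-16) 54 (-6) (-18) (-4) (-2) 2),
   (vec (-18) 0 6 16 (-4) (-8) 0 0 0), (vec (-6) 0 3 6 0 0 18 0 (-6)), (vec 2 (-2) (-1) 0 0 0 4 (-4) (-2))⟩,
  ⟨(vec (-8) 2 4 3 (-3) (-3) 1 (-1) 1), (vec 16 0 (-4) 4 (-4) (-2) (-2) 0 2), (vec (-28) 4 8 (-18) 0 6 (-4) 4 2),
   (vec (-6) 0 0 16 (-4) (-8) (-36) 0 12), (vec (-3) 3 3 6 0 0 (-30) 6 12), (vec (-1) 1 (-1) 0 0 0 (-8) 2 4)⟩,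
  ⟨(vec 4 2 (-2) 15 (-3) (-6) 1 (-1) (-2)), (vec (-12) 4 4 (-26) 2 10 0 (-2) (-2)), (vec (-16) 4 8 30 (-6) (-12) 8 (-2) (-4)),
   (vec (-24) 0 6 16 (-4) (-8) (-108) 12 36), (vec (-15) 3 6 6 0 0 (-54) 6 18), (vec (-1) 1 2 0 0 0 4 2 (-2))⟩,
  ⟨(vec 4 (-4) (-2) 6 0 (-3) (-2) 2 1), (vec (-4) (-4) 0 (-8) 2 4 2 2 0), (vec (-28) 4 8 (-18) 0 6 (-4) 4 2),
   (vec (-10) (-2) 2 16 (-4) (-8) 16 (-4) (-8)), (vec (-6) 0 3 6 0 0 18 0 (-6)), (vec (-2) 2 1 0 0 0 (-4) 4 2)⟩,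
  ⟨(vec (-8) 2 4 3 (-3) (-3) 1 (-1) 1), (vec 16 0 (-4) 4 (-4) (-2) (-2) 0 2), (vec (-16) 4 8 30 (-6) (-12) 8 (-2) (-4)),
   (vec (-10) (-2) 2 16 (-4) (-8) (-80) 8 28), (vec (-3) 3 3 6 0 0 (-30) 6 12), (vec 1 (-1) 1 0 0 0 8 (-2) (-4))⟩,
  ⟨(vec 4 2 (-2) 15 (-3) (-6) 1 (-1) (-2)), (vec (-12) 4 4 (-26) 2 10 0 (-2) (-2)), (vec 44 (-8) (-16) 54 (-6) (-18) (-4) (-2) 2),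
   (vec (-28) 4 8 16 (-4) (-8) (-80) 8 28), (vec (-15) 3 6 6 0 0 (-54) 6 18), (vec 1 (-1) (-2) 0 0 0 (-4) (-2) 2)⟩,
  ⟨(vec 4 (-4) (-2) 6 0 (-3) (-2) 2 1), (vec 0 0 0 (-6) 0 0 0 0 0), (vec (-28) 4 8 (-18) 0 6 (-4) 4 2),
   (vec 4 (-4) (-2) 0 0 0 (-28) 4 8), (vec 6 0 (-3) (-6) 0 0 (-18) 0 6), (vec (-2) 2 1 0 0 0 (-4) 4 2)⟩,
  ⟨(vec (-8) 2 4 3 (-3) (-3) 1 (-1) 1), (vec 0 0 0 (-6) 0 0 0 0 0), (vec (-16) 4 8 30 (-6) (-12) 8 (-2) (-4)),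
   (vec (-8) 2 4 0 0 0 (-16) 4 8), (vec 3 (-3) (-3) (-6) 0 0 30 (-6) (-12)), (vec 1 (-1) 1 0 0 0 8 (-2) (-4))⟩,
  ⟨(vec 4 2 (-2) 15 (-3) (-6) 1 (-1) (-2)), (vec 0 0 0 (-6) 0 0 0 0 0), (vec 44 (-8) (-16) 54 (-6) (-18) (-4) (-2) 2),
   (vec 4 2 (-2) 0 0 0 44 (-8) (-16)), (vec 15 (-3) (-6) (-6) 0 0 54 (-6) (-18)), (vec 1 (-1) (-2) 0 0 0 (-4) (-2) 2)⟩,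
  ⟨(vec (-8) 2 4 3 (-3) (-3) 1 (-1) 1), (vec 0 0 0 (-6) 0 0 0 0 0), (vec (-28) 4 8 (-18) 0 6 (-4) 4 2),
   (vec (-4) 4 2 0 0 0 28 (-4) (-8)), (vec 3 (-3) (-3) (-6) 0 0 30 (-6) (-12)), (vec (-1) 1 (-1) 0 0 0 (-8) 2 4)⟩,
  ⟨(vec 4 2 (-2) 15 (-3) (-6) 1 (-1) (-2)), (vec 0 0 0 (-6) 0 0 0 0 0), (vec (-16) 4 8 30 (-6) (-12) 8 (-2) (-4)),
   (vec 8 (-2) (-4) 0 0 0 16 (-4) (-8)), (vec 15 (-3) (-6) (-6) 0 0 54 (-6) (-18)), (vec (-1) 1 2 0 0 0 4 2 (-2))⟩,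
  ⟨(vec 4 (-4) (-2) 6 0 (-3) (-2) 2 1), (vec 0 0 0 (-6) 0 0 0 0 0), (vec 44 (-8) (-16) 54 (-6) (-18) (-4) (-2) 2),
   (vec (-4) (-2) 2 0 0 0 (-44) 8 16), (vec 6 0 (-3) (-6) 0 0 (-18) 0 6), (vec 2 (-2) (-1) 0 0 0 4 (-4) (-2))⟩]

/-- Subdivision trees, one for each octant. -/
def tree0 : SubTree :=
  (.rot (.rot (.node (vec 8 (-2) (-4) 0 0 0 (-1) 1 (-1)) ⟨1, -1, 1⟩ ⟨-8, 2, 4⟩ ⟨1, 0, 0⟩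
   (.node (vec 62 (-8) (-22) 0 0 0 (-16) 1 5) ⟨9, 0, -3⟩ ⟨9, -1, -3⟩ ⟨1, 0, 0⟩
    (.rot (.rot (.node (vec 0 0 0 (-9) 1 3 (-1) 0 0) ⟨9, -1, -3⟩ ⟨1, 0, 0⟩ ⟨1, 0, 0⟩
     (.leaf 32)
     (.leaf 29))))
    (.leaf 32))
   (.leaf 35))))

def tree1 : SubTree :=
  (.rot (.rot (.node (vec 4 2 (-2) 0 0 0 1 (-1) (-2)) ⟨-1, 1, 2⟩ ⟨4, 2, -2⟩ ⟨1, 0, 0⟩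
   (.rot (.node (vec 4 2 (-2) 15 (-3) (-6) 1 (-1) (-2)) ⟨1, 0, 0⟩ ⟨-15, 3, 6⟩ ⟨1, 0, 0⟩
    (.leaf 29)
    (.rot (.node (vec 0 0 0 (-9) 1 3 (-1) 0 0) ⟨9, -1, -3⟩ ⟨1, 0, 0⟩ ⟨1, 0, 0⟩
     (.leaf 32)
     (.leaf 29)))))
   (.node (vec 2 2 0 0 0 0 (-1) (-1) 0) ⟨-11, 2, 4⟩ ⟨54, 0, -18⟩ ⟨3, 0, 0⟩
    (.rot (.node (vec (-4) 2 2 7 (-2) (-3) 2 (-1) (-1)) ⟨-4, 1, 2⟩ ⟨-21, 6, 9⟩ ⟨3, 0, 0⟩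
     (.rot (.rot (.node (vec (-8) 2 4 0 0 0 2 (-2) (-1)) ⟨-3, 1, 1⟩ ⟨-4, 1, 2⟩ ⟨3, 0, 0⟩
      (.node (vec 24 (-2) (-8) 0 0 0 (-5) (-1) 1) ⟨-4, 1, 2⟩ ⟨-13, 1, 5⟩ ⟨3, 0, 0⟩
       (.leaf 26)
       (.rot (.rot (.node (vec (-52) 10 20 162 (-21) (-57) 36 (-9) (-15)) ⟨27, -3, -9⟩ ⟨1, 1, 0⟩ ⟨1, 0, 0⟩
        (.leaf 22)
        (.leaf 19)))))
      (.rot (.node (vec 18 2 (-4) (-16) 1 5 (-9) (-1) 2) ⟨4, 0, -1⟩ ⟨-3, 1, 1⟩ ⟨1, 0, 0⟩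
       (.leaf 9)
       (.leaf 13))))))
     (.rot (.node (vec 4 2 (-2) 15 (-3) (-6) 1 (-1) (-2)) ⟨-15, 3, 6⟩ ⟨1, 0, 0⟩ ⟨1, 0, 0⟩
      (.leaf 34)
      (.leaf 26)))))
    (.rot (.node (vec (-8) 2 4 (-3) 0 0 0 0 0) ⟨-8, 2, 4⟩ ⟨3, 0, 0⟩ ⟨1, 0, 0⟩
     (.leaf 9)
     (.rot (.node (vec (-4) 2 2 3 (-1) (-1) 2 (-1) (-1)) ⟨-9, 3, 3⟩ ⟨-4, 1, 2⟩ ⟨3, 0, 0⟩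
      (.node (vec (-10) 2 4 19 (-3) (-7) 5 (-1) (-2)) ⟨-11, 2, 4⟩ ⟨3, 0, -1⟩ ⟨1, 0, 0⟩
       (.rot (.rot (.node (vec 8 0 (-2) 7 (-2) (-3) 0 0 0) ⟨-4, 1, 2⟩ ⟨-9, 3, 3⟩ ⟨3, 0, 0⟩
        (.leaf 16)
        (.node (vec 8 0 (-2) 3 (-2) (-2) 0 0 0) ⟨1, 0, 0⟩ ⟨4, 0, -1⟩ ⟨1, 0, 0⟩
         (.leaf 28)
         (.leaf 31)))))
       (.rot (.node (vec 104 (-8) (-34) 6 (-3) (-3) (-16) 1 5) ⟨-11, 2, 4⟩ ⟨-11, 2, 4⟩ ⟨1, 0, 0⟩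
        (.leaf 13)
        (.leaf 16))))
      (.leaf 9)))))))))

def tree2 : SubTree :=
  (.node (vec 8 (-2) (-4) 9 0 (-3) 0 0 0) ⟨-8, 2, 4⟩ ⟨9, 0, -3⟩ ⟨1, 0, 0⟩
   (.rot (.node (vec 22 (-4) (-8) 27 (-3) (-9) (-2) (-1) 1) ⟨3, 0, -1⟩ ⟨2, 1, -1⟩ ⟨1, 0, 0⟩
    (.rot (.rot (.node (vec (-18) 2 6 (-17) 2 6 0 0 0) ⟨14, -2, -4⟩ ⟨-6, 1, 2⟩ ⟨3, 0, 0⟩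
     (.leaf 35)
     (.leaf 24))))
    (.rot (.node (vec 8 (-2) (-4) 0 0 0 (-1) 1 (-1)) ⟨1, -1, 1⟩ ⟨-8, 2, 4⟩ ⟨1, 0, 0⟩
     (.node (vec 62 (-8) (-22) 0 0 0 (-16) 1 5) ⟨9, 0, -3⟩ ⟨9, -1, -3⟩ ⟨1, 0, 0⟩
      (.leaf 29)
      (.leaf 32))
     (.leaf 35)))))
   (.node (vec 8 (-2) (-4) 12 0 (-3) 0 0 0) ⟨1, 0, 0⟩ ⟨3, 0, 0⟩ ⟨1, 0, 0⟩
    (.rot (.rot (.node (vec (-94) 10 32 (-120) 15 42 11 (-2) (-4)) ⟨-11, 2, 4⟩ ⟨-14, 2, 5⟩ ⟨1, 0, 0⟩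
     (.rot (.rot (.node (vec (-94) 10 32 (-162) 21 57 2 (-2) (-1)) ⟨-14, 2, 5⟩ ⟨-2, 2, 1⟩ ⟨1, 0, 0⟩
      (.leaf 14)
      (.node (vec (-582) 70 202 (-993) 120 345 19 (-3) (-7)) ⟨20, -2, -7⟩ ⟨-33, 6, 12⟩ ⟨3, 0, 0⟩
       (.leaf 17)
       (.leaf 29)))))
     (.leaf 23))))
    (.rot (.node (vec 0 0 0 27 (-3) (-9) 4 (-1) (-2)) ⟨27, -3, -9⟩ ⟨-4, 1, 2⟩ ⟨1, 0, 0⟩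
     (.node (vec 0 0 0 36 (-3) (-12) 4 (-1) (-2)) ⟨9, 0, -3⟩ ⟨1, 0, 0⟩ ⟨1, 0, 0⟩
      (.leaf 3)
      (.leaf 10))
     (.rot (.node (vec (-94) 10 32 (-162) 21 57 2 (-2) (-1)) ⟨-2, 2, 1⟩ ⟨-14, 2, 5⟩ ⟨1, 0, 0⟩
      (.node (vec (-582) 70 202 (-993) 120 345 19 (-3) (-7)) ⟨-33, 6, 12⟩ ⟨20, -2, -7⟩ ⟨3, 0, 0⟩
       (.rot (.rot (.node (vec 0 0 0 167 (-20) (-58) 31 (-4) (-11)) ⟨20, -2, -7⟩ ⟨-24, 3, 9⟩ ⟨3, 0, 0⟩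
        (.leaf 17)
        (.leaf 29))))
       (.leaf 17))
      (.rot (.node (vec (-70) 8 24 (-131) 17 46 (-1) (-1) 0) ⟨-31, 4, 11⟩ ⟨-2, 2, 1⟩ ⟨3, 0, 0⟩
       (.leaf 14)
       (.leaf 17)))))))))

def tree3 : SubTree :=
  (.rot (.rot (.node (vec (-22) 4 8 0 0 0 4 (-1) (-2)) ⟨-4, 1, 2⟩ ⟨-22, 4, 8⟩ ⟨1, 0, 0⟩
   (.rot (.rot (.node (vec 0 0 0 27 (-3) (-9) 4 (-1) (-2)) ⟨27, -3, -9⟩ ⟨-4, 1, 2⟩ ⟨1, 0, 0⟩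
    (.node (vec 0 0 0 36 (-3) (-12) 4 (-1) (-2)) ⟨9, 0, -3⟩ ⟨1, 0, 0⟩ ⟨1, 0, 0⟩
     (.leaf 2)
     (.leaf 7))
    (.rot (.node (vec (-178) 22 62 0 0 0 42 (-6) (-15)) ⟨-11, 2, 4⟩ ⟨9, -1, -3⟩ ⟨1, 0, 0⟩
     (.rot (.node (vec 432 (-52) (-150) 1028 (-124) (-357) 40 (-5) (-14)) ⟨-8, 1, 3⟩ ⟨124, -15, -43⟩ ⟨3, 0, 0⟩
      (.rot (.rot (.node (vec (-132) 16 46 0 0 0 (-12) 1 4) ⟨129, -15, -45⟩ ⟨2, 1, -1⟩ ⟨3, 0, 0⟩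
       (.leaf 29)
       (.leaf 26))))
      (.rot (.node (vec 0 0 0 167 (-20) (-58) 31 (-4) (-11)) ⟨20, -2, -7⟩ ⟨-24, 3, 9⟩ ⟨3, 0, 0⟩
       (.leaf 17)
       (.leaf 29)))))
     (.leaf 19))))))
   (.leaf 1))))

def tree4 : SubTree :=
  (.rot (.rot (.node (vec 22 (-4) (-8) 0 0 0 (-11) 2 4) ⟨-11, 2, 4⟩ ⟨-22, 4, 8⟩ ⟨1, 0, 0⟩
   (.rot (.node (vec 46 (-6) (-16) 31 (-4) (-11) (-23) 3 8) ⟨7, -1, -2⟩ ⟨-93, 12, 33⟩ ⟨3, 0, 0⟩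
    (.rot (.node (vec 46 (-6) (-16) 31 (-4) (-11) 4 0 (-1)) ⟨1, 0, 0⟩ ⟨27, -3, -9⟩ ⟨1, 0, 0⟩
     (.rot (.rot (.node (vec (-202) 24 70 (-481) 58 167 101 (-12) (-35)) ⟨26, -3, -9⟩ ⟨-17, 2, 6⟩ ⟨1, 0, 0⟩
      (.leaf 27)
      (.leaf 30))))
     (.rot (.node (vec 22 (-4) (-8) 0 0 0 43 (-4) (-14)) ⟨54, -6, -18⟩ ⟨1, 0, 0⟩ ⟨1, 0, 0⟩
      (.leaf 12)
      (.node (vec (-202) 24 70 0 0 0 (-155) 19 54) ⟨-31, 4, 11⟩ ⟨-31, 4, 11⟩ ⟨6, 0, 0⟩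
       (.leaf 15)
       (.leaf 27))))))
    (.rot (.rot (.node (vec 132 (-16) (-46) 89 (-11) (-31) 12 (-1) (-4)) ⟨78, -9, -27⟩ ⟨3, 0, -1⟩ ⟨1, 0, 0⟩
     (.rot (.rot (.node (vec 0 0 0 (-9) 0 3 (-4) 1 2) ⟨9, 0, -3⟩ ⟨-4, 1, 2⟩ ⟨1, 0, 0⟩
      (.node (vec 0 0 0 (-47) 5 16 (-11) 2 4) ⟨20, -2, -7⟩ ⟨3, 0, -1⟩ ⟨1, 0, 0⟩
       (.leaf 33)
       (.leaf 25))
      (.leaf 21))))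
     (.leaf 30))))))
   (.node (vec 62 (-8) (-22) 0 0 0 20 (-2) (-7)) ⟨-2, 0, 1⟩ ⟨-102, 12, 36⟩ ⟨1, 0, 0⟩
    (.rot (.rot (.node (vec 22 (-4) (-8) 51 (-6) (-18) (-11) 2 4) ⟨-51, 6, 18⟩ ⟨1, 0, 0⟩ ⟨1, 0, 0⟩
     (.leaf 35)
     (.leaf 24))))
    (.leaf 35)))))

def tree5 : SubTree :=
  (.node (vec (-8) 2 4 (-3) 0 0 0 0 0) ⟨-8, 2, 4⟩ ⟨3, 0, 0⟩ ⟨1, 0, 0⟩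
   (.leaf 6)
   (.rot (.node (vec 0 0 0 (-9) 0 3 (-4) 1 2) ⟨9, 0, -3⟩ ⟨-4, 1, 2⟩ ⟨1, 0, 0⟩
    (.rot (.node (vec (-28) 4 10 (-4) 0 1 3 0 (-1)) ⟨-3, 1, 1⟩ ⟨12, -1, -4⟩ ⟨3, 0, 0⟩
     (.rot (.node (vec (-28) 4 10 7 (-2) (-3) 3 0 (-1)) ⟨1, 0, 0⟩ ⟨-11, 2, 4⟩ ⟨1, 0, 0⟩
      (.leaf 25)
      (.rot (.node (vec 0 0 0 (-47) 5 16 (-11) 2 4) ⟨20, -2, -7⟩ ⟨3, 0, -1⟩ ⟨1, 0, 0⟩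
       (.leaf 33)
       (.leaf 25)))))
     (.rot (.node (vec 8 0 (-2) 7 (-2) (-3) 0 0 0) ⟨-4, 1, 2⟩ ⟨-9, 3, 3⟩ ⟨3, 0, 0⟩
      (.leaf 16)
      (.node (vec 8 0 (-2) 3 (-2) (-2) 0 0 0) ⟨1, 0, 0⟩ ⟨4, 0, -1⟩ ⟨1, 0, 0⟩
       (.leaf 28)
       (.rot (.node (vec (-28) 4 10 7 (-2) (-3) 3 0 (-1)) ⟨-11, 2, 4⟩ ⟨1, 0, 0⟩ ⟨1, 0, 0⟩
        (.leaf 31)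
        (.leaf 28))))))))
    (.rot (.rot (.node (vec (-62) 8 22 (-36) 3 12 (-4) 1 2) ⟨9, -1, -3⟩ ⟨1, 0, 0⟩ ⟨1, 0, 0⟩
     (.leaf 18)
     (.leaf 21)))))))

def tree6 : SubTree :=
  (.node (vec 8 (-2) (-4) 9 0 (-3) 0 0 0) ⟨-8, 2, 4⟩ ⟨9, 0, -3⟩ ⟨1, 0, 0⟩
   (.rot (.rot (.node (vec (-6) 0 2 0 0 0 (-2) 0 1) ⟨-2, 0, 1⟩ ⟨6, 0, -2⟩ ⟨1, 0, 0⟩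
    (.rot (.rot (.node (vec (-8) 0 2 (-11) 2 4 4 0 (-1)) ⟨-4, 1, 2⟩ ⟨12, 0, -3⟩ ⟨3, 0, 0⟩
     (.leaf 24)
     (.rot (.node (vec 22 (-4) (-8) 0 0 0 16 (-1) (-5)) ⟨9, 0, -3⟩ ⟨-4, 1, 2⟩ ⟨1, 0, 0⟩
      (.node (vec 22 (-4) (-8) 0 0 0 43 (-4) (-14)) ⟨27, -3, -9⟩ ⟨1, 0, 0⟩ ⟨1, 0, 0⟩
       (.rot (.rot (.node (vec (-8) 0 2 (-11) 2 4 13 0 (-4)) ⟨1, 0, 0⟩ ⟨9, 0, -3⟩ ⟨1, 0, 0⟩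
        (.leaf 15)
        (.leaf 12))))
       (.leaf 15))
      (.node (vec 178 (-22) (-62) 0 0 0 (-89) 11 31) ⟨-17, 2, 6⟩ ⟨-89, 11, 31⟩ ⟨1, 0, 0⟩
       (.leaf 27)
       (.leaf 24)))))))
    (.rot (.node (vec (-18) 2 6 (-17) 2 6 0 0 0) ⟨14, -2, -4⟩ ⟨-6, 1, 2⟩ ⟨3, 0, 0⟩
     (.leaf 35)
     (.leaf 24))))))
   (.node (vec (-8) 0 2 (-15) 3 6 0 0 0) ⟨-4, 1, 2⟩ ⟨-12, 3, 6⟩ ⟨3, 0, 0⟩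
    (.rot (.rot (.node (vec 22 (-4) (-8) 27 (-3) (-9) (-4) 1 2) ⟨-4, 1, 2⟩ ⟨3, 0, -1⟩ ⟨1, 0, 0⟩
     (.rot (.rot (.node (vec (-24) 2 8 (-42) 6 15 4 0 (-1)) ⟨3, 0, -1⟩ ⟨4, 0, -1⟩ ⟨1, 0, 0⟩
      (.leaf 8)
      (.leaf 11))))
     (.node (vec 84 (-12) (-30) 105 (-12) (-36) (-11) 2 4) ⟨3, 0, -1⟩ ⟨3, 0, -1⟩ ⟨1, 0, 0⟩
      (.leaf 20)
      (.leaf 23)))))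
    (.rot (.rot (.node (vec (-24) 2 8 (-42) 6 15 4 0 (-1)) ⟨4, 0, -1⟩ ⟨3, 0, -1⟩ ⟨1, 0, 0⟩
     (.leaf 5)
     (.leaf 4))))))

def tree7 : SubTree :=
  (.leaf 0)

theorem tiles_length : tiles.length = 36 := rfl
theorem tiles_gram : tiles.all Tile.gramOK = true := by decide +kernel
theorem tiles_dual : tiles.all Tile.dualOK = true := by decide +kernel
theorem tiles_inv : tiles.all Tile.invOK = true := by decide +kernel
theorem tiles_sep : sepAll tiles = true := by decide +kernel

/-- The vector with integral coordinates. -/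
def ivec (a b c : ℤ) : Vec := ⟨⟨a, 0, 0⟩, ⟨b, 0, 0⟩, ⟨c, 0, 0⟩⟩

theorem tree0_check : tree0.check tiles (ivec (-1) 0 0) (ivec 0 (-1) 0) (ivec 0 0 (-1)) = true := by
  decide +kernel
theorem tree1_check : tree1.check tiles (ivec (1) 0 0) (ivec 0 (-1) 0) (ivec 0 0 (-1)) = true := by
  decide +kernel
theorem tree2_check : tree2.check tiles (ivec (-1) 0 0) (ivec 0 (1) 0) (ivec 0 0 (-1)) = true := by
  decide +kernel
theorem tree3_check : tree3.check tiles (ivec (1) 0 0) (ivec 0 (1) 0) (ivec 0 0 (-1)) = true := by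
  decide +kernel
theorem tree4_check : tree4.check tiles (ivec (-1) 0 0) (ivec 0 (-1) 0) (ivec 0 0 (1)) = true := by
  decide +kernel
theorem tree5_check : tree5.check tiles (ivec (1) 0 0) (ivec 0 (-1) 0) (ivec 0 0 (1)) = true := by
  decide +kernel
theorem tree6_check : tree6.check tiles (ivec (-1) 0 0) (ivec 0 (1) 0) (ivec 0 0 (1)) = true := by
  decide +kernel
theorem tree7_check : tree7.check tiles (ivec (1) 0 0) (ivec 0 (1) 0) (ivec 0 0 (1)) = true := by
  decide +kernel

/-! ### The real number `τ` -/

/-- `τ = 2 cos 40°`. -/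
noncomputable def tau : ℝ := 2 * Real.cos (2 * Real.pi / 9)

theorem tau_cubic : tau ^ 3 = 3 * tau - 1 := by
  have h := Real.cos_three_mul (2 * Real.pi / 9)
  have h2 : Real.cos (3 * (2 * Real.pi / 9)) = -1 / 2 := by
    rw [show 3 * (2 * Real.pi / 9) = Real.pi - Real.pi / 3 by ring, Real.cos_pi_sub,
      Real.cos_pi_div_three]
    norm_num
  rw [h2] at h
  unfold tau
  linear_combination -2 * h

theorem tau_gt_one : 1 < tau := by
  have h : Real.cos (Real.pi / 3) < Real.cos (2 * Real.pi / 9) := by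
    apply Real.cos_lt_cos_of_nonneg_of_le_pi <;> linarith [Real.pi_pos]
  rw [Real.cos_pi_div_three] at h
  unfold tau
  linarith

theorem tau_lo : (153208888623795607040 : ℝ) / 10 ^ 20 ≤ tau := by
  by_contra! h
  have h1 := tau_gt_one
  have h3 := tau_cubic
  set L : ℝ := 153208888623795607040 / 10 ^ 20 with hL
  have hLv : L ^ 3 - 3 * L + 1 < 0 := by rw [hL]; norm_num
  have hL1 : 1 < L := by rw [hL]; norm_num
  have : 0 < (L - tau) * (L ^ 2 + L * tau + tau ^ 2 - 3) :=
    mul_pos (by linarith) (by nlinarith)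
  nlinarith

theorem tau_hi : tau ≤ (153208888623795607041 : ℝ) / 10 ^ 20 := by
  by_contra! h
  have h1 := tau_gt_one
  have h3 := tau_cubic
  set L : ℝ := 153208888623795607041 / 10 ^ 20 with hL
  have hLv : 0 < L ^ 3 - 3 * L + 1 := by rw [hL]; norm_num
  have hL1 : 1 < L := by rw [hL]; norm_num
  have : 0 < (tau - L) * (L ^ 2 + L * tau + tau ^ 2 - 3) :=
    mul_pos (by linarith) (by nlinarith)
  nlinarith

/-! ### Evaluation -/

noncomputable def K3.ev (k : K3) : ℝ := k.a + k.b * tau + k.c * tau ^ 2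

theorem K3.ev_add (k l : K3) : (k.add l).ev = k.ev + l.ev := by
  simp only [K3.ev, K3.add]; push_cast; ring

theorem K3.ev_neg (k : K3) : k.neg.ev = -k.ev := by
  simp only [K3.ev, K3.neg]; push_cast; ring

theorem K3.ev_mul (k l : K3) : (k.mul l).ev = k.ev * l.ev := by
  simp only [K3.ev, K3.mul]; push_cast
  linear_combination (-((k.b : ℝ) * l.c + k.c * l.b) - k.c * l.c * tau) * tau_cubic

theorem K3.ev_beq {k l : K3} (h : k.beq l = true) : k.ev = l.ev := by
  simp only [K3.beq, Bool.and_eq_true, decide_eq_true_eq] at h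
  obtain ⟨h1, h2, h3⟩ := h
  simp only [K3.ev, h1, h2, h3]

theorem K3.low_le (k : K3) : (k.low : ℝ) ≤ 10 ^ 40 * k.ev := by
  have h1 := tau_lo
  have h2 := tau_hi
  have h0 := tau_gt_one
  have hb : (((if 0 ≤ k.b then k.b * 153208888623795607040
      else k.b * 153208888623795607041 : ℤ)) : ℝ) ≤ 10 ^ 20 * (k.b * tau) := by
    split_ifs with h
    · have : (0 : ℝ) ≤ k.b := by exact_mod_cast h
      push_cast
      rw [div_le_iff₀ (by positivity)] at h1
      nlinarith
    · have : (k.b : ℝ) ≤ 0 := by exact_mod_cast (not_le.mp h).le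
      push_cast
      rw [le_div_iff₀ (by positivity)] at h2
      nlinarith
  have hc : (((if 0 ≤ k.c then k.c * 153208888623795607040 ^ 2
      else k.c * 153208888623795607041 ^ 2 : ℤ)) : ℝ) ≤ 10 ^ 40 * (k.c * tau ^ 2) := by
    split_ifs with h
    · have : (0 : ℝ) ≤ k.c := by exact_mod_cast h
      have h3 := pow_le_pow_left₀ (by positivity) h1 2
      rw [div_pow, div_le_iff₀ (by positivity)] at h3
      have h4 := mul_le_mul_of_nonneg_left h3 this
      push_cast
      linarith
    · have : (k.c : ℝ) ≤ 0 := by exact_mod_cast (not_le.mp h).le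
      have h3 := pow_le_pow_left₀ (by linarith) h2 2
      rw [div_pow, le_div_iff₀ (by positivity)] at h3
      have h4 := mul_le_mul_of_nonpos_left h3 this
      push_cast
      linarith
  unfold K3.low K3.ev
  rw [Int.cast_add, Int.cast_add, Int.cast_mul, Int.cast_mul]
  push_cast at hb hc ⊢
  nlinarith

theorem K3.nn_ev {k : K3} (h : k.nn = true) : 0 ≤ k.ev := by
  simp only [K3.nn, decide_eq_true_eq] at h
  have h1 : (0 : ℝ) ≤ k.low := by exact_mod_cast h
  have := k.low_le
  by_contra! h2
  nlinarith

theorem K3.pos_ev {k : K3} (h : k.pos = true) : 0 < k.ev := by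
  simp only [K3.pos, decide_eq_true_eq] at h
  have h1 : (0 : ℝ) < k.low := by exact_mod_cast h
  have := k.low_le
  by_contra! h2
  nlinarith

/-- The functional `v` at the point with coordinates `a`, `b`, `c`. -/
noncomputable def Vec.app (v : Vec) (a b c : ℝ) : ℝ := v.x.ev * a + v.y.ev * b + v.z.ev * c

theorem Vec.ev_dot (v w : Vec) : (v.dot w).ev = v.app w.x.ev w.y.ev w.z.ev := by
  simp only [Vec.dot, Vec.app, K3.ev_add, K3.ev_mul]; ring

/-- The point with coordinates `a`, `b`, `c` lies in the cone of the tile. -/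
def Tile.Cone (t : Tile) (a b c : ℝ) : Prop :=
  0 ≤ t.f.app a b c ∧ 0 ≤ t.g.app a b c ∧ 0 ≤ t.h.app a b c

theorem app_comb (v p q r : Vec) (x y z : ℝ) :
    v.app (x * p.x.ev + y * q.x.ev + z * r.x.ev) (x * p.y.ev + y * q.y.ev + z * r.y.ev)
      (x * p.z.ev + y * q.z.ev + z * r.z.ev) =
    x * (v.dot p).ev + y * (v.dot q).ev + z * (v.dot r).ev := by
  simp only [Vec.ev_dot, Vec.app]; ring

theorem SubTree.check_sound (l : List Tile) (T : SubTree) : ∀ (p q r : Vec),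
    T.check l p q r = true → ∀ x y z : ℝ, 0 ≤ x → 0 ≤ y → 0 ≤ z →
    ∃ t ∈ l, t.Cone (x * p.x.ev + y * q.x.ev + z * r.x.ev)
      (x * p.y.ev + y * q.y.ev + z * r.y.ev) (x * p.z.ev + y * q.z.ev + z * r.z.ev) := by
  induction T with
  | leaf i =>
    intro p q r h x y z hx hy hz
    simp only [SubTree.check] at h
    split at h
    · exact absurd h (by simp)
    · rename_i t ht
      simp only [Tile.mem, Bool.and_eq_true] at h
      obtain ⟨⟨a1, a2, a3⟩, ⟨b1, b2, b3⟩, c1, c2, c3⟩ := h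
      have := K3.nn_ev a1
      have := K3.nn_ev a2
      have := K3.nn_ev a3
      have := K3.nn_ev b1
      have := K3.nn_ev b2
      have := K3.nn_ev b3
      have := K3.nn_ev c1
      have := K3.nn_ev c2
      have := K3.nn_ev c3
      refine ⟨t, List.mem_of_getElem? ht, ?_, ?_, ?_⟩ <;> rw [app_comb] <;> positivity
  | rot t ih =>
    intro p q r h x y z hx hy hz
    simp only [SubTree.check] at h
    obtain ⟨t, ht, hc⟩ := ih q r p h y z x hy hz hx
    refine ⟨t, ht, ?_⟩
    convert hc using 1 <;> ring
  | node w s t u a b iha ihb =>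
    intro p q r h x y z hx hy hz
    simp only [SubTree.check, K3.comb, Bool.and_eq_true] at h
    obtain ⟨hs, ht, hu, e1, e2, e3, ha, hb⟩ := h
    have hs := K3.pos_ev hs
    have ht := K3.pos_ev ht
    have hu := K3.nn_ev hu
    have e1 := K3.ev_beq e1
    have e2 := K3.ev_beq e2
    have e3 := K3.ev_beq e3
    simp only [K3.ev_add, K3.ev_mul] at e1 e2 e3
    rcases le_total (y * s.ev) (x * t.ev) with hxy | hxy
    · obtain ⟨T, hT, hc⟩ := iha p w r ha (x - y * s.ev / t.ev) (y * u.ev / t.ev) z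
        (by rw [sub_nonneg, div_le_iff₀ ht]; exact hxy) (by positivity) hz
      refine ⟨T, hT, ?_⟩
      convert hc using 1
      · field_simp; linear_combination (-y) * e1
      · field_simp; linear_combination (-y) * e2
      · field_simp; linear_combination (-y) * e3
    · obtain ⟨T, hT, hc⟩ := ihb w q r hb (x * u.ev / s.ev) (y - x * t.ev / s.ev) z
        (by positivity) (by rw [sub_nonneg, div_le_iff₀ hs]; exact hxy) hz
      refine ⟨T, hT, ?_⟩
      convert hc using 1
      · field_simp; linear_combination (-x) * e1
      · field_simp; linear_combination (-x) * e2
      · field_simp; linear_combination (-x) * e3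

theorem octant (T : SubTree) (i j k : ℤ)
    (h : T.check tiles (ivec i 0 0) (ivec 0 j 0) (ivec 0 0 k) = true)
    (a b c : ℝ) (ha : 0 ≤ i * a) (hb : 0 ≤ j * b) (hc : 0 ≤ k * c)
    (hi : (i : ℝ) * i = 1) (hj : (j : ℝ) * j = 1) (hk : (k : ℝ) * k = 1) :
    ∃ t ∈ tiles, t.Cone a b c := by
  obtain ⟨t, ht, h⟩ := SubTree.check_sound _ T _ _ _ h _ _ _ ha hb hc
  refine ⟨t, ht, ?_⟩
  convert h using 1
  · simp only [ivec, K3.ev]; push_cast; linear_combination (-a) * hi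
  · simp only [ivec, K3.ev]; push_cast; linear_combination (-b) * hj
  · simp only [ivec, K3.ev]; push_cast; linear_combination (-c) * hk

/-- The cones of the tiles cover the space. -/
theorem cover (a b c : ℝ) : ∃ t ∈ tiles, t.Cone a b c := by
  rcases le_total 0 a with ha | ha <;> rcases le_total 0 b with hb | hb <;>
    rcases le_total 0 c with hc | hc
  · apply octant _ _ _ _ tree7_check <;> norm_num <;> assumption
  · apply octant _ _ _ _ tree3_check <;> norm_num <;> assumption
  · apply octant _ _ _ _ tree5_check <;> norm_num <;> assumption
  · apply octant _ _ _ _ tree1_check <;> norm_num <;> assumption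
  · apply octant _ _ _ _ tree6_check <;> norm_num <;> assumption
  · apply octant _ _ _ _ tree2_check <;> norm_num <;> assumption
  · apply octant _ _ _ _ tree4_check <;> norm_num <;> assumption
  · apply octant _ _ _ _ tree0_check <;> norm_num <;> assumption

theorem sepBy_sound {s t : Tile} {v : Vec} (h : sepBy s t v = true) :
    (0 ≤ (v.dot s.p).ev ∧ 0 ≤ (v.dot s.q).ev ∧ 0 ≤ (v.dot s.r).ev) ∧
    ((v.dot t.p).ev ≤ 0 ∧ (v.dot t.q).ev ≤ 0 ∧ (v.dot t.r).ev ≤ 0) ∧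
    ∃ w : Vec, v.app w.x.ev w.y.ev w.z.ev ≠ 0 := by
  simp only [sepBy, Bool.and_eq_true, Bool.or_eq_true] at h
  obtain ⟨h1, h2, h3, h4, h5, h6, h7⟩ := h
  have h1 := K3.nn_ev h1
  have h2 := K3.nn_ev h2
  have h3 := K3.nn_ev h3
  rw [K3.ev_neg] at h1 h2 h3
  refine ⟨⟨K3.nn_ev h4, K3.nn_ev h5, K3.nn_ev h6⟩, ⟨by linarith, by linarith, by linarith⟩, ?_⟩
  rcases h7 with h | h | h
  · exact ⟨_, by rw [← Vec.ev_dot]; exact (K3.pos_ev h).ne'⟩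
  · exact ⟨_, by rw [← Vec.ev_dot]; exact (K3.pos_ev h).ne'⟩
  · exact ⟨_, by rw [← Vec.ev_dot]; exact (K3.pos_ev h).ne'⟩

theorem sep_sound {s t : Tile} (h : sep s t = true) : ∃ v, sepBy s t v = true := by
  simp only [sep, Bool.or_eq_true] at h
  rcases h with h | h | h | h | h | h | h <;> exact ⟨_, h⟩

theorem sepAll_sound : ∀ l : List Tile, sepAll l = true →
    l.Pairwise fun s t => ∃ v, sepBy s t v = true
  | [], _ => List.Pairwise.nil
  | s :: l, h => by
    simp only [sepAll, Bool.and_eq_true, List.all_eq_true] at h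
    exact List.Pairwise.cons (fun t ht => sep_sound (h.1 t ht)) (sepAll_sound l h.2)

/-! ### The basic triangle -/

noncomputable def cb : ℝ := 3 - tau ^ 2
noncomputable def cc : ℝ := (-4 + tau + 2 * tau ^ 2) / 3

theorem tau_bd : 1.532 < tau ∧ tau < 1.5321 := by
  have h1 := tau_lo
  have h2 := tau_hi
  constructor
  · refine lt_of_lt_of_le ?_ h1; norm_num
  · refine lt_of_le_of_lt h2 ?_; norm_num

theorem cb_bd : 0 < cb ∧ cb < 1 := by
  have := tau_bd
  unfold cb
  constructor <;> nlinarith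

theorem cc_bd : 0 < cc ∧ cc < 1 := by
  have := tau_bd
  unfold cc
  constructor <;> nlinarith

noncomputable def sb : ℝ := Real.sqrt (1 - cb ^ 2)
noncomputable def sc : ℝ := Real.sqrt (1 - cc ^ 2)

theorem sb_sq : sb ^ 2 = 1 - cb ^ 2 := Real.sq_sqrt (by nlinarith [cb_bd])
theorem sc_sq : sc ^ 2 = 1 - cc ^ 2 := Real.sq_sqrt (by nlinarith [cc_bd])
theorem sb_pos : 0 < sb := Real.sqrt_pos.mpr (by nlinarith [cb_bd])
theorem sc_pos : 0 < sc := Real.sqrt_pos.mpr (by nlinarith [cc_bd])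

noncomputable def vA : EuclideanSpace ℝ (Fin 3) := !₂[0, 0, 1]
noncomputable def vB : EuclideanSpace ℝ (Fin 3) := !₂[sc, 0, cc]
noncomputable def vC : EuclideanSpace ℝ (Fin 3) := !₂[0, sb, cb]

theorem inner_three (x y : EuclideanSpace ℝ (Fin 3)) : ⟪x, y⟫ = x 0 * y 0 + x 1 * y 1 + x 2 * y 2 := by
  simp [PiLp.inner_apply, Fin.sum_univ_three]; ring

theorem iAA : ⟪vA, vA⟫ = 1 := by rw [inner_three]; simp [vA]
theorem iBB : ⟪vB, vB⟫ = 1 := by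
  rw [inner_three]; simp [vB]; linear_combination sc_sq
theorem iCC : ⟪vC, vC⟫ = 1 := by
  rw [inner_three]; simp [vC]; linear_combination sb_sq
theorem iAB : ⟪vA, vB⟫ = cc := by simp [inner_three, vA, vB]
theorem iAC : ⟪vA, vC⟫ = cb := by simp [inner_three, vA, vC]
theorem iBC : ⟪vB, vC⟫ = cc * cb := by simp [inner_three, vB, vC]

theorem norm_one_of_inner {x : EuclideanSpace ℝ (Fin 3)} (h : ⟪x, x⟫ = 1) : ‖x‖ = 1 := by
  rw [real_inner_self_eq_norm_sq] at h
  nlinarith [norm_nonneg x]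

/-- Criterion for the value of a corner angle. -/
theorem cornerAngle_eq {P Q R : EuclideanSpace ℝ (Fin 3)} (hP : ⟪P, P⟫ = 1) (hQ : ⟪Q, Q⟫ = 1) (hR : ⟪R, R⟫ = 1)
    {q r m θ : ℝ} (hq : ⟪Q, P⟫ = q) (hr : ⟪R, P⟫ = r) (hm : ⟪Q, R⟫ = m)
    (hq1 : q ^ 2 < 1) (hr1 : r ^ 2 < 1) (h0 : 0 ≤ θ) (h1 : θ ≤ Real.pi)
    (hc : 0 ≤ Real.cos θ) (hmn : 0 ≤ m - q * r)
    (hsq : (m - q * r) ^ 2 = Real.cos θ ^ 2 * ((1 - q ^ 2) * (1 - r ^ 2))) :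
    cornerAngle P Q R = θ := by
  have hin : ⟪Q - q • P, R - r • P⟫ = m - q * r := by
    simp only [inner_sub_left, inner_sub_right, real_inner_smul_left, real_inner_smul_right,
      hP, hq, hm, real_inner_comm R P ▸ hr]
    ring
  have hn1 : ‖Q - q • P‖ ^ 2 = 1 - q ^ 2 := by
    rw [← real_inner_self_eq_norm_sq]
    simp only [inner_sub_left, inner_sub_right, real_inner_smul_left, real_inner_smul_right,
      hP, hq, hQ, real_inner_comm Q P ▸ hq]
    ring
  have hn2 : ‖R - r • P‖ ^ 2 = 1 - r ^ 2 := by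
    rw [← real_inner_self_eq_norm_sq]
    simp only [inner_sub_left, inner_sub_right, real_inner_smul_left, real_inner_smul_right,
      hP, hr, hR, real_inner_comm R P ▸ hr]
    ring
  have hp1 : 0 < ‖Q - q • P‖ := by
    rcases (norm_nonneg (Q - q • P)).eq_or_lt with h | h
    · rw [← h] at hn1; nlinarith
    · exact h
  have hp2 : 0 < ‖R - r • P‖ := by
    rcases (norm_nonneg (R - r • P)).eq_or_lt with h | h
    · rw [← h] at hn2; nlinarith
    · exact h
  have hval : m - q * r = Real.cos θ * (‖Q - q • P‖ * ‖R - r • P‖) := by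
    have : (m - q * r) ^ 2 = (Real.cos θ * (‖Q - q • P‖ * ‖R - r • P‖)) ^ 2 := by
      rw [mul_pow, mul_pow, hn1, hn2, hsq]
    exact (sq_eq_sq₀ hmn (by positivity)).mp this
  unfold cornerAngle InnerProductGeometry.angle
  rw [hq, hr, hin, hval, mul_div_assoc, div_self (by positivity), mul_one,
    Real.arccos_cos h0 h1]

theorem tau_pow4 : tau ^ 4 = 3 * tau ^ 2 - tau := by
  linear_combination tau * tau_cubic

theorem cb_tau : cb * tau = 1 := by
  unfold cb; linear_combination -tau_cubic

theorem cc_sq : cc ^ 2 = (4 - tau ^ 2) / 3 := by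
  unfold cc
  linear_combination (4 / 9 * tau + 4 / 9) * tau_cubic

theorem angleA : cornerAngle vA vB vC = Real.pi / 2 := by
  have h1 := cb_bd
  have h2 := cc_bd
  apply cornerAngle_eq iAA iBB iCC (real_inner_comm vA vB ▸ iAB) (real_inner_comm vA vC ▸ iAC) iBC
  · nlinarith
  · nlinarith
  · positivity
  · linarith [Real.pi_pos]
  · simp
  · simp
  · simp

theorem angleB : cornerAngle vB vA vC = Real.pi / 3 := by
  have h1 := cb_bd
  have h2 := cc_bd
  apply cornerAngle_eq iBB iAA iCC iAB (real_inner_comm vB vC ▸ iBC) iAC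
  · nlinarith
  · nlinarith [mul_pos h1.1 h2.1, mul_lt_one_of_nonneg_of_lt_one_left h2.1.le h2.2 h1.2.le]
  · positivity
  · linarith [Real.pi_pos]
  · simp
  · nlinarith [mul_pos h1.1 h2.1]
  · rw [Real.cos_pi_div_three]
    have h : 4 * cb ^ 2 * (1 - cc ^ 2) = 1 - cb ^ 2 * cc ^ 2 := by
      rw [cc_sq]
      linear_combination (cb * tau + 1) * cb_tau
    linear_combination (1 - cc ^ 2) / 4 * h

theorem angleC : cornerAngle vC vA vB = 5 * Real.pi / 18 := by
  have h1 := cb_bd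
  have h2 := cc_bd
  have hs : Real.cos (5 * Real.pi / 18) ^ 2 = 1 - tau ^ 2 / 4 := by
    rw [show 5 * Real.pi / 18 = Real.pi / 2 - 2 * Real.pi / 9 by ring, Real.cos_pi_div_two_sub,
      Real.sin_sq]
    unfold tau; ring
  apply cornerAngle_eq iCC iAA iBB iAC iBC iAB
  · nlinarith
  · nlinarith [mul_pos h1.1 h2.1, mul_lt_one_of_nonneg_of_lt_one_left h2.1.le h2.2 h1.2.le]
  · positivity
  · linarith [Real.pi_pos]
  · apply Real.cos_nonneg_of_neg_pi_div_two_le_of_le <;> linarith [Real.pi_pos]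
  · nlinarith [mul_pos h1.1 h2.1]
  · rw [hs]
    have h : cc ^ 2 * (1 - cb ^ 2) = (1 - tau ^ 2 / 4) * (1 - cb ^ 2 * cc ^ 2) := by
      rw [cc_sq]
      linear_combination ((4 - tau ^ 2) / 12) * (-1) * (cb * tau + 1) * cb_tau
    linear_combination (1 - cb ^ 2) * h

/-- The linear combination of the basic vectors. -/
noncomputable def pt (a b c : ℝ) : EuclideanSpace ℝ (Fin 3) := a • vA + b • vB + c • vC

theorem pt_surj (x : EuclideanSpace ℝ (Fin 3)) : ∃ a b c, x = pt a b c := by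
  have h1 := sb_pos
  have h2 := sc_pos
  refine ⟨x 2 - x 0 / sc * cc - x 1 / sb * cb, x 0 / sc, x 1 / sb, ?_⟩
  ext i
  fin_cases i
  · simp [pt, vA, vB, vC]; field_simp
  · simp [pt, vA, vB, vC]; field_simp
  · simp [pt, vA, vB, vC]; ring

theorem lin_indep : LinearIndependent ℝ ![vA, vB, vC] := by
  have h1 := sb_pos
  have h2 := sc_pos
  rw [Fintype.linearIndependent_iff]
  intro g hg
  simp only [Fin.sum_univ_three] at hg
  have e0 := congrArg (fun v : EuclideanSpace ℝ (Fin 3) => v 0) hg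
  have e1 := congrArg (fun v : EuclideanSpace ℝ (Fin 3) => v 1) hg
  have e2 := congrArg (fun v : EuclideanSpace ℝ (Fin 3) => v 2) hg
  simp [vA, vB, vC, h1.ne', h2.ne'] at e0 e1 e2
  rw [e0, e1] at e2
  intro i
  fin_cases i
  · simpa using e2
  · exact e0
  · exact e1

noncomputable def bas : Module.Basis (Fin 3) ℝ (EuclideanSpace ℝ (Fin 3)) :=
  basisOfLinearIndependentOfCardEqFinrank lin_indep (by simp)

theorem bas0 : bas 0 = vA := by simp [bas]
theorem bas1 : bas 1 = vB := by simp [bas]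
theorem bas2 : bas 2 = vC := by simp [bas]

theorem constr_pt (w : Fin 3 → EuclideanSpace ℝ (Fin 3)) (a b c : ℝ) :
    bas.constr ℝ w (pt a b c) = a • w 0 + b • w 1 + c • w 2 := by
  simp only [pt, map_add, map_smul, ← bas0, ← bas1, ← bas2, Module.Basis.constr_basis]

theorem inner_comb {P Q R : EuclideanSpace ℝ (Fin 3)} (a b c a' b' c' : ℝ) :
    ⟪a • P + b • Q + c • R, a' • P + b' • Q + c' • R⟫ =
      a * a' * ⟪P, P⟫ + b * b' * ⟪Q, Q⟫ + c * c' * ⟪R, R⟫ + (a * b' + b * a') * ⟪P, Q⟫ +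
      (a * c' + c * a') * ⟪P, R⟫ + (b * c' + c * b') * ⟪Q, R⟫ := by
  simp only [inner_add_left, inner_add_right, real_inner_smul_left, real_inner_smul_right,
    real_inner_comm P Q, real_inner_comm P R, real_inner_comm Q R]
  ring

/-- Triangles with the same Gram matrix are congruent. -/
theorem exists_isometry {P Q R : EuclideanSpace ℝ (Fin 3)} (hPP : ⟪P, P⟫ = 1) (hQQ : ⟪Q, Q⟫ = 1) (hRR : ⟪R, R⟫ = 1)
    (hPQ : ⟪P, Q⟫ = cc) (hPR : ⟪P, R⟫ = cb) (hQR : ⟪Q, R⟫ = cc * cb) :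
    ∃ g : EuclideanSpace ℝ (Fin 3) ≃ₗᵢ[ℝ] EuclideanSpace ℝ (Fin 3), sphericalTriangle P Q R = g '' sphericalTriangle vA vB vC := by
  have key : ∀ x y : EuclideanSpace ℝ (Fin 3), ⟪bas.constr ℝ ![P, Q, R] x, bas.constr ℝ ![P, Q, R] y⟫ = ⟪x, y⟫ := by
    intro x y
    obtain ⟨a, b, c, rfl⟩ := pt_surj x
    obtain ⟨a', b', c', rfl⟩ := pt_surj y
    rw [constr_pt, constr_pt, pt, pt]
    simp only [Matrix.cons_val_zero, Matrix.cons_val_one, Matrix.cons_val]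
    rw [inner_comb, inner_comb, hPP, hQQ, hRR, hPQ, hPR, hQR, iAA, iBB, iCC, iAB, iAC, iBC]
  let g0 : EuclideanSpace ℝ (Fin 3) →ₗᵢ[ℝ] EuclideanSpace ℝ (Fin 3) := (bas.constr ℝ ![P, Q, R]).isometryOfInner key
  let g : EuclideanSpace ℝ (Fin 3) ≃ₗᵢ[ℝ] EuclideanSpace ℝ (Fin 3) := g0.toLinearIsometryEquiv rfl
  have hg : ∀ a b c : ℝ, g (a • vA + b • vB + c • vC) = a • P + b • Q + c • R := by
    intro a b c
    exact constr_pt ![P, Q, R] a b c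
  refine ⟨g, ?_⟩
  ext x
  constructor
  · rintro ⟨hx, s, t, u, hs, ht, hu, rfl⟩
    refine ⟨s • vA + t • vB + u • vC, ⟨?_, s, t, u, hs, ht, hu, rfl⟩, hg s t u⟩
    rw [mem_sphere_zero_iff_norm] at hx ⊢
    rw [← hx, ← hg, g.norm_map]
  · rintro ⟨y, ⟨hy, s, t, u, hs, ht, hu, rfl⟩, rfl⟩
    refine ⟨?_, s, t, u, hs, ht, hu, hg s t u⟩
    rw [mem_sphere_zero_iff_norm] at hy ⊢
    rw [g.norm_map, hy]

/-! ### The tiles as subsets of the sphere -/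

noncomputable def Vec.pt (v : Vec) : EuclideanSpace ℝ (Fin 3) := _root_.pt (v.x.ev / 6) (v.y.ev / 6) (v.z.ev / 6)

theorem inner_vec_pt (v w : Vec) : ⟪v.pt, w.pt⟫ = (v.gram w).ev / 108 := by
  unfold Vec.pt _root_.pt
  rw [inner_comb, iAA, iBB, iCC, iAB, iAC, iBC]
  have hbc : cc * cb = (-11 + 2 * tau + 4 * tau ^ 2) / 3 := by
    unfold cc cb
    linear_combination (-2 / 3 * tau - 1 / 3) * tau_cubic
  rw [hbc]
  simp only [Vec.gram, Vec.ev_dot, Vec.app, gramA, gramB, gramC]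
  simp only [K3.ev, cb, cc]
  push_cast
  ring

def Tile.set (t : Tile) : Set (EuclideanSpace ℝ (Fin 3)) := sphericalTriangle t.p.pt t.q.pt t.r.pt

theorem Tile.exists_isometry {t : Tile} (h : t.gramOK = true) :
    ∃ g : EuclideanSpace ℝ (Fin 3) ≃ₗᵢ[ℝ] EuclideanSpace ℝ (Fin 3), t.set = g '' sphericalTriangle vA vB vC := by
  simp only [Tile.gramOK, Bool.and_eq_true] at h
  obtain ⟨h1, h2, h3, h4, h5, h6⟩ := h
  have hbc : cc * cb = (-11 + 2 * tau + 4 * tau ^ 2) / 3 := by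
    unfold cc cb
    linear_combination (-2 / 3 * tau - 1 / 3) * tau_cubic
  apply _root_.exists_isometry
  · rw [inner_vec_pt, K3.ev_beq h1]; simp [K3.ev]
  · rw [inner_vec_pt, K3.ev_beq h2]; simp [K3.ev]
  · rw [inner_vec_pt, K3.ev_beq h3]; simp [K3.ev]
  · rw [inner_vec_pt, K3.ev_beq h4]; simp only [K3.ev, cc]; push_cast; ring
  · rw [inner_vec_pt, K3.ev_beq h5]; simp only [K3.ev, cb]; push_cast; ring
  · rw [inner_vec_pt, K3.ev_beq h6, hbc]; simp only [K3.ev]; push_cast; ring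

theorem Tile.mem_set {t : Tile} (hi : t.invOK = true) {a b c : ℝ} (h : t.Cone a b c)
    (hx : pt a b c ∈ Metric.sphere (0 : EuclideanSpace ℝ (Fin 3)) 1) : pt a b c ∈ t.set := by
  refine ⟨hx, t.f.app a b c / 6, t.g.app a b c / 6, t.h.app a b c / 6,
    div_nonneg h.1 (by norm_num), div_nonneg h.2.1 (by norm_num),
    div_nonneg h.2.2 (by norm_num), ?_⟩
  simp only [Tile.invOK, Bool.and_eq_true] at hi
  obtain ⟨h1, h2, h3, h4, h5, h6, h7, h8, h9⟩ := hi
  have h1 := K3.ev_beq h1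
  have h2 := K3.ev_beq h2
  have h3 := K3.ev_beq h3
  have h4 := K3.ev_beq h4
  have h5 := K3.ev_beq h5
  have h6 := K3.ev_beq h6
  have h7 := K3.ev_beq h7
  have h8 := K3.ev_beq h8
  have h9 := K3.ev_beq h9
  simp only [K3.ev_add, K3.ev_mul] at h1 h2 h3 h4 h5 h6 h7 h8 h9
  have z0 : K3.ev ⟨0, 0, 0⟩ = 0 := by simp [K3.ev]
  have z1 : K3.ev ⟨36, 0, 0⟩ = 36 := by simp [K3.ev]
  rw [z0] at h2 h3 h4 h6 h7 h8
  rw [z1] at h1 h5 h9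
  have e : ∀ a1 b1 c1 a2 b2 c2 : ℝ, a1 = a2 → b1 = b2 → c1 = c2 → pt a1 b1 c1 = pt a2 b2 c2 := by
    rintro _ _ _ _ _ _ rfl rfl rfl; rfl
  have e2 : ∀ s t' u a1 b1 c1 a2 b2 c2 a3 b3 c3 : ℝ,
      s • pt a1 b1 c1 + t' • pt a2 b2 c2 + u • pt a3 b3 c3 =
      pt (s * a1 + t' * a2 + u * a3) (s * b1 + t' * b2 + u * b3) (s * c1 + t' * c2 + u * c3) := by
    intros; unfold pt; module
  unfold Vec.pt
  rw [e2]
  apply e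
  · unfold Vec.app; linear_combination (-a / 36) * h1 + (-b / 36) * h2 + (-c / 36) * h3
  · unfold Vec.app; linear_combination (-a / 36) * h4 + (-b / 36) * h5 + (-c / 36) * h6
  · unfold Vec.app; linear_combination (-a / 36) * h7 + (-b / 36) * h8 + (-c / 36) * h9

/-- The linear functional given by a vector. -/
noncomputable def Vec.fn (v : Vec) : EuclideanSpace ℝ (Fin 3) →ₗ[ℝ] ℝ := bas.constr ℝ ![v.x.ev, v.y.ev, v.z.ev]

theorem Vec.fn_pt (v : Vec) (a b c : ℝ) : v.fn (_root_.pt a b c) = v.app a b c := by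
  simp only [_root_.pt, Vec.fn, map_add, map_smul, ← bas0, ← bas1, ← bas2,
    Module.Basis.constr_basis, Vec.app]
  simp
  ring

theorem Vec.fn_vec (v w : Vec) : v.fn w.pt = (v.dot w).ev / 6 := by
  rw [Vec.pt, Vec.fn_pt, Vec.ev_dot, Vec.app, Vec.app]; ring

/-- A great circle has empty interior. -/
theorem no_open (φ : EuclideanSpace ℝ (Fin 3) →ₗ[ℝ] ℝ) (v : EuclideanSpace ℝ (Fin 3)) (hv : φ v ≠ 0)
    (U : Set (Metric.sphere (0 : EuclideanSpace ℝ (Fin 3)) 1)) (hU : IsOpen U) (h : ∀ x ∈ U, φ x = 0) : U = ∅ := by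
  by_contra hne
  obtain ⟨x, hx⟩ := Set.nonempty_iff_ne_empty.mpr hne
  have hx0 := h x hx
  have hxn : ‖(x : EuclideanSpace ℝ (Fin 3))‖ = 1 := mem_sphere_zero_iff_norm.mp x.2
  have hne0 : ∀ s : ℝ, (x : EuclideanSpace ℝ (Fin 3)) + s • v ≠ 0 := by
    intro s hs
    have h1 : φ ((x : EuclideanSpace ℝ (Fin 3)) + s • v) = 0 := by rw [hs, map_zero]
    rw [map_add, map_smul, hx0, zero_add, smul_eq_mul, mul_eq_zero] at h1
    rcases h1 with h1 | h1
    · rw [h1, zero_smul, add_zero] at hs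
      rw [hs, norm_zero] at hxn
      norm_num at hxn
    · exact hv h1
  let y : ℝ → Metric.sphere (0 : EuclideanSpace ℝ (Fin 3)) 1 := fun s =>
    ⟨‖(x : EuclideanSpace ℝ (Fin 3)) + s • v‖⁻¹ • ((x : EuclideanSpace ℝ (Fin 3)) + s • v), by
      rw [mem_sphere_zero_iff_norm, norm_smul, norm_inv, norm_norm,
        inv_mul_cancel₀ (norm_ne_zero_iff.mpr (hne0 s))]⟩
  have hy : Continuous y := by
    apply Continuous.subtype_mk
    have h1 : Continuous fun s : ℝ => ‖(x : EuclideanSpace ℝ (Fin 3)) + s • v‖⁻¹ :=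
      Continuous.inv₀ (by fun_prop) (fun s => norm_ne_zero_iff.mpr (hne0 s))
    fun_prop
  have hy0 : y 0 = x := by
    apply Subtype.ext
    simp [y, hxn]
  have hnh : y ⁻¹' U ∈ nhds (0 : ℝ) := (hU.preimage hy).mem_nhds (by
    rw [Set.mem_preimage, hy0]; exact hx)
  obtain ⟨ε, hε, hb⟩ := Metric.mem_nhds_iff.mp hnh
  have hm : ε / 2 ∈ y ⁻¹' U := hb (by
    rw [Metric.mem_ball, Real.dist_eq, sub_zero, abs_of_pos (by positivity)]; linarith)
  have h2 := h _ hm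
  simp only [y, map_smul, map_add, hx0, zero_add, smul_eq_mul] at h2
  have hpos : ‖(x : EuclideanSpace ℝ (Fin 3)) + (ε / 2) • v‖⁻¹ ≠ 0 := inv_ne_zero (norm_ne_zero_iff.mpr (hne0 _))
  have : ε / 2 ≠ 0 := by positivity
  exact mul_ne_zero hpos (mul_ne_zero this hv) h2

theorem disjoint_of_sep {s t : Tile} (h : ∃ v, sepBy s t v = true) :
    Disjoint (interior ((↑) ⁻¹' s.set : Set (Metric.sphere (0 : EuclideanSpace ℝ (Fin 3)) 1)))
      (interior ((↑) ⁻¹' t.set : Set (Metric.sphere (0 : EuclideanSpace ℝ (Fin 3)) 1))) := by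
  obtain ⟨v, h⟩ := h
  obtain ⟨⟨a1, a2, a3⟩, ⟨b1, b2, b3⟩, w, hw⟩ := sepBy_sound h
  rw [Set.disjoint_iff_inter_eq_empty]
  apply no_open v.fn (pt w.x.ev w.y.ev w.z.ev) (by rwa [Vec.fn_pt]) _
    (isOpen_interior.inter isOpen_interior)
  rintro x ⟨hs, ht⟩
  obtain ⟨-, c1, c2, c3, hc1, hc2, hc3, e⟩ := interior_subset hs
  obtain ⟨-, d1, d2, d3, hd1, hd2, hd3, e'⟩ := interior_subset ht
  apply le_antisymm
  · rw [e', map_add, map_add, map_smul, map_smul, map_smul, Vec.fn_vec, Vec.fn_vec, Vec.fn_vec,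
      smul_eq_mul, smul_eq_mul, smul_eq_mul]
    nlinarith [mul_nonneg hd1 (neg_nonneg.mpr b1), mul_nonneg hd2 (neg_nonneg.mpr b2),
      mul_nonneg hd3 (neg_nonneg.mpr b3)]
  · rw [e, map_add, map_add, map_smul, map_smul, map_smul, Vec.fn_vec, Vec.fn_vec, Vec.fn_vec,
      smul_eq_mul, smul_eq_mul, smul_eq_mul]
    positivity

/-- Existence of the new tiling `T(6α⁴, 2β⁶, 6βγ⁶; 6α², 6β³)` with 36 tiles by a
triangle with angles `(π/2, π/3, 5π/18)`. -/
theorem thirtysix_tile_tiling :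
    ∃ A B C : EuclideanSpace ℝ (Fin 3),
      LinearIndependent ℝ ![A, B, C] ∧ ‖A‖ = 1 ∧ ‖B‖ = 1 ∧ ‖C‖ = 1 ∧
      cornerAngle A B C = Real.pi / 2 ∧
      cornerAngle B A C = Real.pi / 3 ∧
      cornerAngle C A B = 5 * Real.pi / 18 ∧
      ∃ T : Fin 36 → Set (EuclideanSpace ℝ (Fin 3)),
        (∀ i, ∃ g : EuclideanSpace ℝ (Fin 3) ≃ₗᵢ[ℝ] EuclideanSpace ℝ (Fin 3),
          T i = g '' sphericalTriangle A B C) ∧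
        (⋃ i, T i) = Metric.sphere (0 : EuclideanSpace ℝ (Fin 3)) 1 ∧
        Pairwise fun i j => Disjoint
          (interior ((↑) ⁻¹' T i : Set (Metric.sphere (0 : EuclideanSpace ℝ (Fin 3)) 1)))
          (interior ((↑) ⁻¹' T j : Set (Metric.sphere (0 : EuclideanSpace ℝ (Fin 3)) 1))) := by
  refine ⟨vA, vB, vC, lin_indep, norm_one_of_inner iAA, norm_one_of_inner iBB,
    norm_one_of_inner iCC, angleA, angleB, angleC,
    fun i => (tiles[(i : ℕ)]'(by rw [tiles_length]; exact i.2)).set, ?_, ?_, ?_⟩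
  · intro i
    exact Tile.exists_isometry (List.all_eq_true.mp tiles_gram _ (List.getElem_mem _))
  · apply Set.Subset.antisymm
    · exact Set.iUnion_subset fun i => Set.inter_subset_left
    · intro x hx
      obtain ⟨a, b, c, rfl⟩ := pt_surj x
      obtain ⟨t, ht, hc⟩ := cover a b c
      have hm := Tile.mem_set (List.all_eq_true.mp tiles_inv _ ht) hc hx
      obtain ⟨n, hn, rfl⟩ := List.getElem_of_mem ht
      exact Set.mem_iUnion.mpr ⟨⟨n, by rwa [tiles_length] at hn⟩, hm⟩
  · have hp := List.pairwise_iff_getElem.mp (sepAll_sound _ tiles_sep)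
    intro i j hij
    rcases lt_or_gt_of_ne hij with h | h
    · exact disjoint_of_sep (hp i j _ _ h)
    · exact (disjoint_of_sep (hp j i _ _ h)).symm
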